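/- (Lemma 3.26) If the focused presentation Π,Σ ⊢ is derivable, then ⌈Π⌉, ⌈Σ⌉ ⊢ is derivable in the unpolarized sequent calculus; and if Π ⊢f Σ is derivable in the focused calculus, then ⌈Π⌉, ⌈Σ⁻⌉ ⊢ is derivable in the unpolarized sequent calculus. -/

import Mathlib

/-- Unpolarized formulas of LG/CNL.  `ldiv B A` denotes `B\A`, `lsub B A` denotes `B⦸A`,
`rdiv A B` denotes `A/B`, `rsub A B` denotes `A⊘B`. -/
inductive Fm : Type
  | pos : Nat → Fm                -- positive atom p
  | neg : Nat → Fm                -- negative atom p̄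
  | tens : Fm → Fm → Fm           -- A ⊗ B
  | par : Fm → Fm → Fm            -- A ⊕ B
  | rdiv : Fm → Fm → Fm           -- A / B
  | ldiv : Fm → Fm → Fm           -- B \ A  (ldiv B A)
  | rsub : Fm → Fm → Fm           -- A ⊘ B
  | lsub : Fm → Fm → Fm           -- B ⦸ A  (lsub B A)
  | conj : Fm → Fm → Fm           -- A ∧ B
  | disj : Fm → Fm → Fm           -- A ∨ B

/-- Linear negation. -/
def Fm.dual : Fm → Fm
  | .pos n => .neg n
  | .neg n => .pos n
  | .tens A B => .par B.dual A.dual        -- (A⊗B)⊥ = B⊥⊕A⊥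
  | .par A B => .tens B.dual A.dual        -- (A⊕B)⊥ = B⊥⊗A⊥
  | .rdiv A B => .lsub B.dual A.dual       -- (A/B)⊥ = B⊥⦸A⊥
  | .lsub B A => .rdiv A.dual B.dual       -- (B⦸A)⊥ = A⊥/B⊥
  | .ldiv B A => .rsub A.dual B.dual       -- (B\A)⊥ = A⊥⊘B⊥
  | .rsub A B => .ldiv B.dual A.dual       -- (A⊘B)⊥ = B⊥\A⊥
  | .conj A B => .disj B.dual A.dual       -- (A∧B)⊥ = B⊥∨A⊥
  | .disj A B => .conj B.dual A.dual       -- (A∨B)⊥ = B⊥∧A⊥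
/-- Structures: Γ ::= A | Γ·⊗·Δ | Γ·⊘·Δ | Δ·⦸·Γ.
`slsub Δ Γ` denotes `Δ·⦸·Γ`, `srsub Γ Δ` denotes `Γ·⊘·Δ`. -/
inductive Str : Type
  | fm : Fm → Str
  | stens : Str → Str → Str
  | srsub : Str → Str → Str
  | slsub : Str → Str → Str

mutual
/-- The positive formula interpretation Γ⁺ of a structure. -/
def Str.posF : Str → Fm
  | .fm A => A
  | .stens Γ Δ => .tens Γ.posF Δ.posF
  | .srsub Γ Δ => .rsub Γ.posF Δ.negF
  | .slsub Δ Γ => .lsub Δ.negF Γ.posF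
/-- The negative formula interpretation Γ⁻ of a structure. -/
def Str.negF : Str → Fm
  | .fm A => A.dual
  | .stens Γ Δ => .par Δ.negF Γ.negF
  | .srsub Γ Δ => .ldiv Δ.posF Γ.negF
  | .slsub Δ Γ => .rdiv Γ.negF Δ.posF
end

/-- One-sided sequent derivability `DSeq g c Γ Δ` of the presentation `Γ,Δ ⊢`.
The flag `g` enables the Grishin (linear distributivity) structural rules of LG_I,
the flag `c` enables the CNL structural rules.  Thus `DSeq false false` is LG∅,
`DSeq true false` is LG_I, and `DSeq false true` is CNL. -/
inductive DSeq : Bool → Bool → Str → Str → Prop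
  | ax {g c A} : DSeq g c (.fm A) (.fm A.dual)
  | cut {g c Γ Δ A} : DSeq g c Δ (.fm A) → DSeq g c Γ (.fm A.dual) → DSeq g c Γ Δ
  | sym {g c Γ Δ} : DSeq g c Γ Δ → DSeq g c Δ Γ
  | dp1 {g c Γ Δ Θ} : DSeq g c (.stens Γ Δ) Θ → DSeq g c Γ (.slsub Δ Θ)
  | dp1' {g c Γ Δ Θ} : DSeq g c Γ (.slsub Δ Θ) → DSeq g c (.stens Γ Δ) Θ
  | dp2 {g c Γ Δ Θ} : DSeq g c Γ (.stens Δ Θ) → DSeq g c (.srsub Γ Δ) Θ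
  | dp2' {g c Γ Δ Θ} : DSeq g c (.srsub Γ Δ) Θ → DSeq g c Γ (.stens Δ Θ)
  | tensL {g c Γ A B} : DSeq g c Γ (.stens (.fm A) (.fm B)) → DSeq g c Γ (.fm (.tens A B))
  | lsubL {g c Γ A B} : DSeq g c Γ (.slsub (.fm B.dual) (.fm A)) → DSeq g c Γ (.fm (.lsub B A))
  | rsubL {g c Γ A B} : DSeq g c Γ (.srsub (.fm A) (.fm B.dual)) → DSeq g c Γ (.fm (.rsub A B))
  | parL {g c Γ Δ A B} : DSeq g c Γ (.fm A) → DSeq g c Δ (.fm B) →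
      DSeq g c (.stens Δ Γ) (.fm (.par A B))
  | rdivL {g c Γ Δ A B} : DSeq g c Δ (.fm B.dual) → DSeq g c Γ (.fm A) →
      DSeq g c (.slsub Δ Γ) (.fm (.rdiv A B))
  | ldivL {g c Γ Δ A B} : DSeq g c Δ (.fm B.dual) → DSeq g c Γ (.fm A) →
      DSeq g c (.srsub Γ Δ) (.fm (.ldiv B A))
  | conjL1 {g c Γ A B} : DSeq g c Γ (.fm A) → DSeq g c Γ (.fm (.conj A B))
  | conjL2 {g c Γ A B} : DSeq g c Γ (.fm B) → DSeq g c Γ (.fm (.conj A B))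
  | disjL {g c Γ A B} : DSeq g c Γ (.fm A) → DSeq g c Γ (.fm B) → DSeq g c Γ (.fm (.disj A B))
  -- Grishin structural rules (LG_I)
  | gr1 {c Γ₁ Γ₂ Δ₁ Δ₂} : DSeq true c (.srsub Γ₂ Δ₂) (.srsub Δ₁ Γ₁) →
      DSeq true c (.stens Γ₁ Γ₂) (.stens Δ₂ Δ₁)
  | gr2 {c Γ₁ Γ₂ Δ₁ Δ₂} : DSeq true c (.slsub Δ₁ Γ₁) (.slsub Γ₂ Δ₂) →
      DSeq true c (.stens Γ₁ Γ₂) (.stens Δ₂ Δ₁)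
  | gr3 {c Γ₁ Γ₂ Δ₁ Δ₂} : DSeq true c (.srsub Δ₂ Γ₁) (.slsub Δ₁ Γ₂) →
      DSeq true c (.stens Γ₁ Γ₂) (.stens Δ₂ Δ₁)
  -- CNL structural rules
  | cnl1 {g Γ Δ Θ} : DSeq g true Γ (.srsub Δ Θ) → DSeq g true Γ (.stens Δ Θ)
  | cnl1' {g Γ Δ Θ} : DSeq g true Γ (.stens Δ Θ) → DSeq g true Γ (.srsub Δ Θ)
  | cnl2 {g Γ Δ Θ} : DSeq g true Γ (.slsub Δ Θ) → DSeq g true Γ (.stens Δ Θ)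
  | cnl2' {g Γ Δ Θ} : DSeq g true Γ (.stens Δ Θ) → DSeq g true Γ (.slsub Δ Θ)
mutual
/-- Positive polarized formulas.  `rsub P N` denotes `P⊘N`, `lsub N P` denotes `N⦸P`. -/
inductive PFm : Type
  | pos : Nat → PFm               -- atom p
  | tens : PFm → PFm → PFm        -- P ⊗ Q
  | rsub : PFm → NFm → PFm        -- P ⊘ N
  | lsub : NFm → PFm → PFm        -- N ⦸ P
  | disj : PFm → PFm → PFm        -- P ∨ Q
  | down : NFm → PFm              -- ↓N
/-- Negative polarized formulas.  `rdiv M Q` denotes `M/Q`, `ldiv Q M` denotes `Q\M`. -/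
inductive NFm : Type
  | neg : Nat → NFm               -- atom p̄
  | par : NFm → NFm → NFm         -- M ⊕ N
  | ldiv : PFm → NFm → NFm        -- Q \ M
  | rdiv : NFm → PFm → NFm        -- M / Q
  | conj : NFm → NFm → NFm        -- M ∧ N
  | up : PFm → NFm                -- ↑P
end

mutual
/-- Polarized linear negation (positive to negative). -/
def PFm.dual : PFm → NFm
  | .pos n => .neg n
  | .tens P Q => .par Q.dual P.dual        -- (P⊗Q)⊥ = Q⊥⊕P⊥
  | .rsub P N => .ldiv N.dual P.dual       -- (P⊘N)⊥ = N⊥\P⊥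
  | .lsub N P => .rdiv P.dual N.dual       -- (N⦸P)⊥ = P⊥/N⊥
  | .disj P Q => .conj Q.dual P.dual       -- (P∨Q)⊥ = Q⊥∧P⊥
  | .down N => .up N.dual                  -- (↓N)⊥ = ↑(N⊥)
/-- Polarized linear negation (negative to positive). -/
def NFm.dual : NFm → PFm
  | .neg n => .pos n
  | .par M N => .tens N.dual M.dual        -- (M⊕N)⊥ = N⊥⊗M⊥
  | .ldiv Q M => .rsub M.dual Q.dual       -- (Q\M)⊥ = M⊥⊘Q⊥
  | .rdiv M Q => .lsub Q.dual M.dual       -- (M/Q)⊥ = Q⊥⦸M⊥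
  | .conj M N => .disj N.dual M.dual       -- (M∧N)⊥ = N⊥∨M⊥
  | .up P => .down P.dual                  -- (↑P)⊥ = ↓(P⊥)
end
/-- A polarized formula: either positive or negative. -/
abbrev Pol : Type := PFm ⊕ NFm

mutual
/-- The subformula map σ on negative polarized formulas. -/
def ssig : NFm → Set Pol
  | .up P => insert (Sum.inr P.dual) (ttau P)       -- σ(↑P) = {P⊥} ∪ τ(P)
  | .neg n => {Sum.inr (.neg n)}
  | .conj M N => ssig M ∪ ssig N
  | .par M N => ssig M ∪ ssig N
  | .rdiv M Q => ssig M ∪ ttau Q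
  | .ldiv Q M => ssig M ∪ ttau Q
/-- The subformula map τ on positive polarized formulas. -/
def ttau : PFm → Set Pol
  | .down N => insert (Sum.inr N) (ssig N)          -- τ(↓N) = {N} ∪ σ(N)
  | .pos n => {Sum.inl (.pos n)}
  | .disj P Q => ttau P ∪ ttau Q
  | .tens P Q => ttau P ∪ ttau Q
  | .lsub N P => ttau P ∪ ssig N
  | .rsub P N => ttau P ∪ ssig N
end

/-- The closure X^τ = ⋃ { τ(↓N) | N ∈ X } of a set X of negative formulas. -/
def Xtau (X : Set NFm) : Set Pol := {a | ∃ N ∈ X, a ∈ ttau (.down N)}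
/-- Focused structures: π ::= p | N | π·⊗·σ | π·⊘·σ | σ·⦸·π, where a negative formula `N`
stands for its implicit ↓-shift.  `slsub σ π` denotes `σ·⦸·π`, `srsub π σ` denotes `π·⊘·σ`. -/
inductive FStr : Type
  | at : Nat → FStr
  | nfm : NFm → FStr
  | stens : FStr → FStr → FStr
  | srsub : FStr → FStr → FStr
  | slsub : FStr → FStr → FStr

/-- The decomposition relation `Tstar P σ`, i.e. `σ ∈ τ*(P)`:
τ*(P⊗Q)={π·⊗·σ | π∈τ*(P), σ∈τ*(Q)}, τ*(P⊘N)={π·⊘·σ | π∈τ*(P), σ∈τ*(N⊥)},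
τ*(N⦸P)={σ·⦸·π | π∈τ*(P), σ∈τ*(N⊥)}, τ*(P∨Q)=τ*(P)∪τ*(Q), τ*(p)={p}, τ*(↓N)={N}. -/
inductive Tstar : PFm → FStr → Prop
  | tens {P Q π σ} : Tstar P π → Tstar Q σ → Tstar (.tens P Q) (.stens π σ)
  | rsub {P N π σ} : Tstar P π → Tstar N.dual σ → Tstar (.rsub P N) (.srsub π σ)
  | lsub {N P π σ} : Tstar P π → Tstar N.dual σ → Tstar (.lsub N P) (.slsub σ π)
  | disjl {P Q π} : Tstar P π → Tstar (.disj P Q) π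
  | disjr {P Q π} : Tstar Q π → Tstar (.disj P Q) π
  | at {n} : Tstar (.pos n) (.at n)
  | down {N} : Tstar (.down N) (.nfm N)
/-- One-hole contexts over focused structures. -/
inductive FCtx : Type
  | hole : FCtx
  | tensL : FCtx → FStr → FCtx      -- π[]·⊗·σ
  | tensR : FStr → FCtx → FCtx      -- π·⊗·σ[]
  | rsubL : FCtx → FStr → FCtx      -- π[]·⊘·σ
  | rsubR : FStr → FCtx → FCtx      -- π·⊘·σ[]
  | lsubL : FCtx → FStr → FCtx      -- σ[]·⦸·π
  | lsubR : FStr → FCtx → FCtx      -- σ·⦸·π[]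

/-- Substitution `π[υ]` of a structure for the hole of a context. -/
def FCtx.fill : FCtx → FStr → FStr
  | .hole, υ => υ
  | .tensL c σ, υ => .stens (c.fill υ) σ
  | .tensR π c, υ => .stens π (c.fill υ)
  | .rsubL c σ, υ => .srsub (c.fill υ) σ
  | .rsubR π c, υ => .srsub π (c.fill υ)
  | .lsubL c π, υ => .slsub (c.fill υ) π
  | .lsubR σ c, υ => .slsub σ (c.fill υ)

/-- The display map `π[] ÷ υ`. -/
def FCtx.div : FCtx → FStr → FStr
  | .hole, υ => υ
  | .tensL c σ, υ => c.div (.slsub σ υ)       -- (π[]·⊗·σ)÷υ = π[]÷(σ·⦸·υ)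
  | .tensR π c, υ => c.div (.srsub υ π)       -- (π·⊗·σ[])÷υ = σ[]÷(υ·⊘·π)
  | .rsubL c σ, υ => c.div (.stens σ υ)       -- (π[]·⊘·σ)÷υ = π[]÷(σ·⊗·υ)
  | .rsubR π c, υ => c.div (.slsub υ π)       -- (π·⊘·σ[])÷υ = σ[]÷(υ·⦸·π)
  | .lsubR σ c, υ => c.div (.stens υ σ)       -- (σ·⦸·π[])÷υ = π[]÷(υ·⊗·σ)
  | .lsubL c π, υ => c.div (.srsub π υ)       -- (σ[]·⦸·π)÷υ = σ[]÷(π·⊘·υ)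
mutual
/-- Strongly focused derivability of presentations `π,σ ⊢`, relative to the parameter
set `X` of negative formulas.  The rule (D) covers both presentation contexts
`ω[] = ⟨π[],σ⟩` and `ω[] = ⟨σ,π[]⟩`, with `ω*[] = π[]÷σ`. -/
inductive FSeq (X : Set NFm) : FStr → FStr → Prop
  | decL {N σ'} (c : FCtx) (υ : FStr) : Sum.inr N ∈ Xtau X → Tstar N.dual σ' →
      FFoc X (c.div υ) σ' → FSeq X (c.fill (.nfm N)) υ
  | decR {N σ'} (c : FCtx) (υ : FStr) : Sum.inr N ∈ Xtau X → Tstar N.dual σ' →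
      FFoc X (c.div υ) σ' → FSeq X υ (c.fill (.nfm N))
/-- Strongly focused derivability `π ⊢f σ` (context splitting judgement). -/
inductive FFoc (X : Set NFm) : FStr → FStr → Prop
  | id {n} : FFoc X (.at n) (.at n)
  | react {π N} : (∀ σ, Tstar N.dual σ → FSeq X π σ) → FFoc X π (.nfm N)
  | tens {π π' σ σ'} : FFoc X π π' → FFoc X σ σ' → FFoc X (.stens π σ) (.stens π' σ')
  | rsub {π π' σ σ'} : FFoc X σ σ' → FFoc X π π' → FFoc X (.srsub π σ) (.srsub π' σ')
  | lsub {π π' σ σ'} : FFoc X σ σ' → FFoc X π π' → FFoc X (.slsub σ π) (.slsub σ' π')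
end
mutual
/-- The positive formula interpretation σ⁺ of a focused structure (shifts left implicit:
a negative formula `N` occurring in a structure stands for `↓N`). -/
def FStr.posF : FStr → PFm
  | .at n => .pos n
  | .nfm N => .down N
  | .stens π σ => .tens π.posF σ.posF
  | .srsub π σ => .rsub π.posF σ.negF
  | .slsub σ π => .lsub σ.negF π.posF
/-- The negative formula interpretation σ⁻ of a focused structure. -/
def FStr.negF : FStr → NFm
  | .at n => .neg n
  | .nfm N => .up N.dual
  | .stens π σ => .par σ.negF π.negF
  | .srsub π σ => .ldiv σ.posF π.negF
  | .slsub σ π => .rdiv π.negF σ.posF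
end
mutual
/-- The forgetful map ⌈·⌉ erasing shifts (on positive formulas). -/
def forgetP : PFm → Fm
  | .pos n => .pos n
  | .tens P Q => .tens (forgetP P) (forgetP Q)
  | .rsub P N => .rsub (forgetP P) (forgetN N)
  | .lsub N P => .lsub (forgetN N) (forgetP P)
  | .disj P Q => .disj (forgetP P) (forgetP Q)
  | .down N => forgetN N
/-- The forgetful map ⌈·⌉ erasing shifts (on negative formulas). -/
def forgetN : NFm → Fm
  | .neg n => .neg n
  | .par M N => .par (forgetN M) (forgetN N)
  | .ldiv Q M => .ldiv (forgetP Q) (forgetN M)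
  | .rdiv M Q => .rdiv (forgetN M) (forgetP Q)
  | .conj M N => .conj (forgetN M) (forgetN N)
  | .up P => forgetP P
end

/-- The forgetful map ⌈·⌉ on focused structures. -/
def forgetFS : FStr → Str
  | .at n => .fm (.pos n)
  | .nfm N => .fm (forgetN N)
  | .stens π σ => .stens (forgetFS π) (forgetFS σ)
  | .srsub π σ => .srsub (forgetFS π) (forgetFS σ)
  | .slsub σ π => .slsub (forgetFS σ) (forgetFS π)

theorem Fm.dual_dual : ∀ A : Fm, A.dual.dual = A := by
  intro A
  induction A <;> simp_all [Fm.dual]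

mutual
theorem pdual_dual : ∀ P : PFm, P.dual.dual = P
  | .pos n => rfl
  | .tens P Q => by simp [PFm.dual, NFm.dual, pdual_dual P, pdual_dual Q]
  | .rsub P N => by simp [PFm.dual, NFm.dual, pdual_dual P, ndual_dual N]
  | .lsub N P => by simp [PFm.dual, NFm.dual, pdual_dual P, ndual_dual N]
  | .disj P Q => by simp [PFm.dual, NFm.dual, pdual_dual P, pdual_dual Q]
  | .down N => by simp [PFm.dual, NFm.dual, ndual_dual N]
theorem ndual_dual : ∀ N : NFm, N.dual.dual = N
  | .neg n => rfl
  | .par M N => by simp [PFm.dual, NFm.dual, ndual_dual M, ndual_dual N]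
  | .ldiv Q M => by simp [PFm.dual, NFm.dual, ndual_dual M, pdual_dual Q]
  | .rdiv M Q => by simp [PFm.dual, NFm.dual, ndual_dual M, pdual_dual Q]
  | .conj M N => by simp [PFm.dual, NFm.dual, ndual_dual M, ndual_dual N]
  | .up P => by simp [PFm.dual, NFm.dual, pdual_dual P]
end

mutual
theorem forget_pdual : ∀ P : PFm, forgetN P.dual = (forgetP P).dual
  | .pos n => rfl
  | .tens P Q => by simp [PFm.dual, forgetP, forgetN, Fm.dual, forget_pdual P, forget_pdual Q]
  | .rsub P N => by simp [PFm.dual, forgetP, forgetN, Fm.dual, forget_pdual P, forget_ndual N]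
  | .lsub N P => by simp [PFm.dual, forgetP, forgetN, Fm.dual, forget_pdual P, forget_ndual N]
  | .disj P Q => by simp [PFm.dual, forgetP, forgetN, Fm.dual, forget_pdual P, forget_pdual Q]
  | .down N => by simp [PFm.dual, forgetP, forgetN, forget_ndual N]
theorem forget_ndual : ∀ N : NFm, forgetP N.dual = (forgetN N).dual
  | .neg n => rfl
  | .par M N => by simp [NFm.dual, forgetP, forgetN, Fm.dual, forget_ndual M, forget_ndual N]
  | .ldiv Q M => by simp [NFm.dual, forgetP, forgetN, Fm.dual, forget_ndual M, forget_pdual Q]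
  | .rdiv M Q => by simp [NFm.dual, forgetP, forgetN, Fm.dual, forget_ndual M, forget_pdual Q]
  | .conj M N => by simp [NFm.dual, forgetP, forgetN, Fm.dual, forget_ndual M, forget_ndual N]
  | .up P => by simp [NFm.dual, forgetP, forgetN, forget_pdual P]
end

theorem negF_eq (s : FStr) :
    forgetN s.negF = (forgetP s.posF).dual ∧ (forgetN s.negF).dual = forgetP s.posF := by
  suffices h : forgetN s.negF = (forgetP s.posF).dual from ⟨h, by rw [h, Fm.dual_dual]⟩
  induction s with
  | nfm N => simp [FStr.negF, FStr.posF, forgetP, forgetN, forget_ndual]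
  | _ => simp_all [FStr.negF, FStr.posF, forgetP, forgetN, Fm.dual, Fm.dual_dual]

abbrev DD := DSeq false false

theorem sw {Γ Δ : Str} : DD Γ Δ ↔ DD Δ Γ := ⟨.sym, .sym⟩
theorem dt2 {Γ Δ Θ : Str} : DD Γ (.stens Δ Θ) ↔ DD (.srsub Γ Δ) Θ := ⟨.dp2, .dp2'⟩
theorem dl1 {Γ Δ Θ : Str} : DD Γ (.slsub Δ Θ) ↔ DD (.stens Γ Δ) Θ := ⟨.dp1', .dp1⟩
theorem dt1 {Γ Δ Θ : Str} : DD Γ (.stens Δ Θ) ↔ DD (.slsub Θ Γ) Δ := by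
  rw [sw, ← dl1, sw]
theorem dr1 {Γ Δ Θ : Str} : DD Γ (.srsub Δ Θ) ↔ DD (.stens Θ Γ) Δ := by
  rw [sw, ← dt2, sw]
theorem dr2 {Γ Δ Θ : Str} : DD Γ (.srsub Δ Θ) ↔ DD (.slsub Γ Δ) Θ := by
  rw [dr1, ← dl1, sw]
theorem dl2 {Γ Δ Θ : Str} : DD Γ (.slsub Δ Θ) ↔ DD (.srsub Θ Γ) Δ := by
  rw [dl1, sw, dt2]

def RR (P : PFm) : Prop :=
  ∀ Γ, (∀ σ, Tstar P σ → DD Γ (forgetFS σ)) → DD Γ (.fm (forgetP P))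

theorem RR_tens {P Q} (hP : RR P) (hQ : RR Q) : RR (.tens P Q) := fun Γ h => by
  refine .tensL (dt1.2 (hP _ fun π hπ => dt1.1 (dt2.2 (hQ _ fun σ hσ => dt2.1 ?_))))
  exact h _ (.tens hπ hσ)
theorem RR_rsub {P N} (hP : RR P) (hQ : RR N.dual) : RR (.rsub P N) := fun Γ h => by
  refine .rsubL ?_
  rw [← forget_ndual]
  refine (dr1.2 (hP _ fun π hπ => dr1.1 (dr2.2 (hQ _ fun σ hσ => dr2.1 ?_))))
  exact h _ (.rsub hπ hσ)
theorem RR_lsub {P N} (hP : RR P) (hQ : RR N.dual) : RR (.lsub N P) := fun Γ h => by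
  refine .lsubL ?_
  rw [← forget_ndual]
  refine (dl1.2 (hP _ fun π hπ => dl1.1 (dl2.2 (hQ _ fun σ hσ => dl2.1 ?_))))
  exact h _ (.lsub hπ hσ)
theorem RR_disj {P Q} (hP : RR P) (hQ : RR Q) : RR (.disj P Q) := fun Γ h =>
  .disjL (hP _ fun _ hσ => h _ (.disjl hσ)) (hQ _ fun _ hσ => h _ (.disjr hσ))
theorem RR_down {N} : RR (.down N) := fun Γ h => h _ .down

mutual
theorem RR_P : ∀ P, RR P
  | .pos n => fun Γ h => h _ .at
  | .tens P Q => RR_tens (RR_P P) (RR_P Q)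
  | .rsub P N => RR_rsub (RR_P P) (RR_N N)
  | .lsub N P => RR_lsub (RR_P P) (RR_N N)
  | .disj P Q => RR_disj (RR_P P) (RR_P Q)
  | .down N => RR_down
theorem RR_N : ∀ N : NFm, RR N.dual
  | .neg n => fun Γ h => h _ .at
  | .par M N => RR_tens (RR_N N) (RR_N M)
  | .ldiv Q M => RR_rsub (RR_N M) ((pdual_dual Q).symm ▸ RR_P Q)
  | .rdiv M Q => RR_lsub (RR_N M) ((pdual_dual Q).symm ▸ RR_P Q)
  | .conj M N => RR_disj (RR_N N) (RR_N M)
  | .up P => RR_down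
end

theorem fold_pos (s : FStr) : ∀ Γ, DD Γ (forgetFS s) → DD Γ (.fm (forgetP s.posF)) := by
  induction s with
  | nfm N => exact fun _ h => h
  | stens a b iha ihb =>
    exact fun Γ h => .tensL (dt1.2 (iha _ (dt1.1 (dt2.2 (ihb _ (dt2.1 h))))))
  | srsub a b iha ihb =>
    intro Γ h
    refine .rsubL ?_
    rw [(negF_eq b).2]
    exact dr1.2 (iha _ (dr1.1 (dr2.2 (ihb _ (dr2.1 h)))))
  | slsub b a ihb iha =>
    intro Γ h
    refine .lsubL ?_
    rw [(negF_eq b).2]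
    exact dl1.2 (iha _ (dl1.1 (dl2.2 (ihb _ (dl2.1 h)))))
  | _ => exact fun _ h => h

theorem tstar_ax {P σ} (h : Tstar P σ) : DD (forgetFS σ) (.fm (forgetP P).dual) := by
  induction h with
  | tens _ _ ih1 ih2 => exact .parL ih2 ih1
  | rsub _ _ ih1 ih2 =>
    rw [forget_ndual] at ih2
    exact .ldivL ih2 ih1
  | lsub _ _ ih1 ih2 =>
    rw [forget_ndual] at ih2
    exact .rdivL ih2 ih1
  | disjl _ ih => exact .conjL2 ih
  | disjr _ ih => exact .conjL1 ih
  | _ => exact .ax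

theorem fill_div (c : FCtx) (x : FStr) : ∀ υ,
    DD (forgetFS υ) (forgetFS (c.fill x)) ↔ DD (forgetFS (c.div υ)) (forgetFS x) := by
  induction c with
  | hole => exact fun _ => Iff.rfl
  | tensL c σ ih => exact fun υ => dt1.trans (ih (.slsub σ υ))
  | tensR π c ih => exact fun υ => dt2.trans (ih (.srsub υ π))
  | rsubL c σ ih => exact fun υ => dr1.trans (ih (.stens σ υ))
  | rsubR π c ih => exact fun υ => dr2.trans (ih (.slsub υ π))
  | lsubL c π ih => exact fun υ => dl2.trans (ih (.srsub π υ))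
  | lsubR σ c ih => exact fun υ => dl1.trans (ih (.stens υ σ))

theorem dec_step {N σ'} (c : FCtx) (υ : FStr) (ht : Tstar N.dual σ')
    (h : DD (forgetFS (c.div υ)) (.fm (forgetN σ'.negF))) :
    DD (forgetFS υ) (forgetFS (c.fill (.nfm N))) := by
  rw [fill_div]
  have h1 := tstar_ax ht
  rw [forget_ndual, Fm.dual_dual] at h1
  have h2 := fold_pos _ _ (DSeq.sym h1)
  rw [(negF_eq σ').1] at h
  exact .cut h2 h

mutual
theorem seq_sound {X : Set NFm} : ∀ {π σ : FStr}, FSeq X π σ → DD (forgetFS π) (forgetFS σ)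
  | _, _, .decL c υ _ ht h => .sym (dec_step c υ ht (foc_sound h))
  | _, _, .decR c υ _ ht h => dec_step c υ ht (foc_sound h)
theorem foc_sound {X : Set NFm} : ∀ {π σ : FStr}, FFoc X π σ →
    DD (forgetFS π) (.fm (forgetN σ.negF))
  | _, _, .id => .ax
  | _, _, .react h => RR_N _ _ fun σ hσ => seq_sound (h σ hσ)
  | _, _, .tens h1 h2 => .parL (foc_sound h2) (foc_sound h1)
  | _, _, .rsub h1 h2 => .ldivL ((negF_eq _).1 ▸ foc_sound h1) (foc_sound h2)
  | _, _, .lsub h1 h2 => .rdivL ((negF_eq _).1 ▸ foc_sound h1) (foc_sound h2)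
end

/-- Lemma 3.26: if the focused presentation `π,σ ⊢` is derivable then
`⌈π⌉, ⌈σ⌉ ⊢` is derivable in the unpolarized sequent calculus; and if `π ⊢f σ` is
derivable then `⌈π⌉, ⌈σ⁻⌉ ⊢` is derivable in the unpolarized sequent calculus. -/
theorem focused_to_unpolarized (X : Set NFm) :
    (∀ π σ : FStr, FSeq X π σ → DSeq false false (forgetFS π) (forgetFS σ)) ∧
    (∀ π σ : FStr, FFoc X π σ → DSeq false false (forgetFS π) (.fm (forgetN σ.negF))) := by
  exact ⟨fun _ _ h => seq_sound h, fun _ _ h => foc_sound h⟩
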